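/- Let E be a finite-dimensional real inner product space and let K be a simplicial complex in E with finitely many faces, with underlying space |K| (the union of the closed cells, where the closed cell of a face is the convex hull of its vertices). Let U ⊆ E be an open set such that for every face of K the intersection of U with the closed cell of that face is convex. Let |K_U| denote the union of the closed cells of those faces of K whose closed cell is disjoint from U (this is the underlying space of the maximal subcomplex of K contained in |K| ∖ U). Then |K_U| is a strong deformation retract of |K| ∖ U: there exists a continuous map H : (|K| ∖ U) × [0,1] → |K| ∖ U with H(x,0) = x for all x, H(x,1) ∈ |K_U| for all x, and H(x,t) = x for all t ∈ [0,1] whenever x ∈ |K_U|. -/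

import Mathlib

open Geometry

/-- Strong deformation retract, with honest functions on `E`. -/
def SDRAux {E : Type*} [NormedAddCommGroup E] [InnerProductSpace ℝ E] (X A : Set E) : Prop :=
  ∃ F : E × ℝ → E, ContinuousOn F (X ×ˢ Set.Icc (0 : ℝ) 1) ∧
    (∀ x ∈ X, ∀ t ∈ Set.Icc (0 : ℝ) 1, F (x, t) ∈ X) ∧
    (∀ x ∈ X, F (x, 0) = x) ∧ (∀ x ∈ X, F (x, 1) ∈ A) ∧
    (∀ x ∈ X, x ∈ A → ∀ t ∈ Set.Icc (0 : ℝ) 1, F (x, t) = x)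

section
variable {E : Type*} [NormedAddCommGroup E] [InnerProductSpace ℝ E]

lemma SDRAux.refl (X A : Set E) (h : X ⊆ A) : SDRAux X A :=
  ⟨fun q => q.1, continuous_fst.continuousOn, fun x hx _ _ => hx, fun _ _ => rfl,
    fun x hx => h hx, fun _ _ _ _ _ => rfl⟩

lemma SDRAux.trans {X Y A : Set E} (hYX : Y ⊆ X) (hAY : X ∩ A ⊆ Y) (h1 : SDRAux X Y)
    (h2 : SDRAux Y A) : SDRAux X A := by
  obtain ⟨F, Fc, FX, F0, F1, FA⟩ := h1
  obtain ⟨G, Gc, GX, G0, G1, GA⟩ := h2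
  have key : ∀ x t, x ∈ X → t ∈ Set.Icc (0 : ℝ) 1 →
      (t ≤ 1/2 ∧ F (x, min (2*t) 1) + G (F (x, 1), max (2*t-1) 0) - F (x, 1) = F (x, 2*t)) ∨
      (1/2 ≤ t ∧ F (x, min (2*t) 1) + G (F (x, 1), max (2*t-1) 0) - F (x, 1)
        = G (F (x, 1), 2*t-1)) := by
    intro x t hx ht
    rcases le_total t (1/2) with h | h
    · left
      refine ⟨h, ?_⟩
      rw [min_eq_left (by linarith), max_eq_right (by linarith), G0 _ (F1 x hx)]
      abel
    · right
      refine ⟨h, ?_⟩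
      rw [min_eq_right (by linarith), max_eq_left (by linarith)]
      abel
  have c1 : ContinuousOn (fun q : E × ℝ => F (q.1, 1)) (X ×ˢ Set.Icc (0 : ℝ) 1) :=
    Fc.comp (by fun_prop) (fun q hq => ⟨hq.1, by simp⟩)
  refine ⟨fun q => F (q.1, min (2*q.2) 1) + G (F (q.1, 1), max (2*q.2-1) 0) - F (q.1, 1),
    ?_, ?_, ?_, ?_, ?_⟩
  · refine ((Fc.comp (by fun_prop) ?_).add (Gc.comp (c1.prodMk (by fun_prop)) ?_)).sub c1
    · rintro ⟨x, t⟩ ⟨hx, ht⟩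
      refine ⟨hx, ?_, min_le_right _ _⟩
      have := ht.1
      simp only at this
      exact le_min (by simp only; linarith) (by norm_num)
    · rintro ⟨x, t⟩ ⟨hx, ht⟩
      refine ⟨F1 _ hx, le_max_right _ _, ?_⟩
      have := ht.2
      simp only at this
      exact max_le (by simp only; linarith) (by norm_num)
  · intro x hx t ht
    rcases key x t hx ht with ⟨h, e⟩ | ⟨h, e⟩
    · simp only [e]
      exact FX x hx _ ⟨by linarith [ht.1], by linarith⟩
    · simp only [e]
      exact hYX (GX _ (F1 x hx) _ ⟨by linarith, by linarith [ht.2]⟩)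
  · intro x hx
    have h2 := G0 _ (F1 x hx)
    simp [h2, F0 x hx]
  · intro x hx
    have : max ((2:ℝ)*1-1) 0 = 1 := by norm_num
    have h3 : min ((2:ℝ)*1) 1 = 1 := by norm_num
    simp only [this, h3]
    simpa using G1 _ (F1 x hx)
  · intro x hx hA t ht
    have hY := hAY ⟨hx, hA⟩
    have e1 : F (x, 1) = x := FA x hx hY 1 (by simp)
    rcases key x t hx ht with ⟨h, e⟩ | ⟨h, e⟩
    · simp only [e]
      exact FA x hx hY _ ⟨by linarith [ht.1], by linarith⟩
    · refine Eq.trans e ?_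
      rw [e1]
      exact GA x hY hA _ ⟨by linarith, by linarith [ht.2]⟩

open Classical in
/-- Barycentric coordinates. -/
lemma exists_bary [FiniteDimensional ℝ E] (s : Finset E)
    (hs : AffineIndependent ℝ ((↑) : s → E)) :
    ∃ b : E → (E →ᵃ[ℝ] ℝ), ∀ v ∈ s, ∀ w ∈ s, b v w = if v = w then 1 else 0 := by
  obtain ⟨t, hst, ht, hspan⟩ := exists_subset_affineIndependent_affineSpan_eq_top hs
  let B : AffineBasis t ℝ E := ⟨((↑) : t → E), ht, by simpa using hspan⟩
  refine ⟨fun v => if h : v ∈ t then B.coord ⟨v, h⟩ else 0, fun v hv w hw => ?_⟩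
  have hv' : v ∈ t := hst hv
  have hw' : w ∈ t := hst hw
  have := B.coord_apply ⟨v, hv'⟩ ⟨w, hw'⟩
  simp only [hv', dif_pos]
  have e : B ⟨w, hw'⟩ = w := rfl
  rw [e] at this
  simpa using this

lemma bary_sum (f : E →ᵃ[ℝ] ℝ) (s : Finset E) (w : E → ℝ) (hw : ∑ v ∈ s, w v = 1) :
    f (∑ v ∈ s, w v • v) = ∑ v ∈ s, w v * f v := by
  have h : ∀ x, f x = f.linear x + f 0 := fun x => congrFun f.decomp x
  rw [h, map_sum]
  conv_rhs => enter [2, v]; rw [h v, mul_add]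
  rw [Finset.sum_add_distrib, ← Finset.sum_mul, hw]
  simp

open Classical in
lemma bary_hull {s : Finset E} {b : E → (E →ᵃ[ℝ] ℝ)}
    (hb : ∀ v ∈ s, ∀ w ∈ s, b v w = if v = w then 1 else 0) {x : E}
    (hx : x ∈ convexHull ℝ (s : Set E)) :
    (∀ v ∈ s, 0 ≤ b v x) ∧ ∑ v ∈ s, b v x = 1 ∧ ∑ v ∈ s, b v x • v = x := by
  obtain ⟨w, w0, w1, wx⟩ := Finset.mem_convexHull'.1 hx
  have h : ∀ v ∈ s, b v x = w v := by
    intro v hv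
    rw [← wx, bary_sum _ _ _ w1, Finset.sum_congr rfl (fun u hu => by rw [hb v hv u hu])]
    simp [hv]
  refine ⟨fun v hv => (h v hv) ▸ w0 v hv, ?_, ?_⟩
  · rw [Finset.sum_congr rfl h, w1]
  · rw [Finset.sum_congr rfl (fun v hv => by rw [h v hv]), wx]

/-- The radial push from an interior point `p`. -/
lemma radial [FiniteDimensional ℝ E] (K K' : SimplicialComplex ℝ E) (hKfin : K.faces.Finite)
    (U : Set E) (hU : IsOpen U) (s : Finset E) (hs : s ∈ K.faces)
    (hmax : ∀ t ∈ K.faces, s ⊆ t → s = t)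
    (hc : Convex ℝ (U ∩ convexHull ℝ (s : Set E)))
    (hK' : K'.faces = K.faces \ {s})
    (hne : ¬ Disjoint (convexHull ℝ (s : Set E)) U) :
    SDRAux (K.space \ U) (K'.space \ U) := by
  classical
  obtain ⟨b, hb⟩ := exists_bary s (K.indep hs)
  have sne : s.Nonempty := SimplicialComplex.nonempty_of_mem_faces hs
  have bcont : ∀ v, Continuous (b v) := fun v => (b v).continuous_of_finiteDimensional
  set C := convexHull ℝ (s : Set E) with hC
  have Ccl : IsClosed C := (s.finite_toSet.isCompact_convexHull ℝ).isClosed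
  have Lcl : IsClosed K'.space := by
    refine (Set.Finite.isClosed_biUnion (hK' ▸ hKfin.subset Set.sdiff_subset) fun t _ => ?_)
    exact (t.finite_toSet.isCompact_convexHull ℝ).isClosed
  have hsp : ∀ x, x ∈ K.space ↔ x ∈ C ∨ x ∈ K'.space := by
    intro x
    simp only [SimplicialComplex.mem_space_iff, hK']
    constructor
    · rintro ⟨t, ht, hx⟩
      by_cases h : t = s
      · subst h; exact Or.inl hx
      · exact Or.inr ⟨t, ⟨ht, h⟩, hx⟩
    · rintro (h | ⟨t, ht, hx⟩)
      · exact ⟨s, hs, h⟩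
      · exact ⟨t, ht.1, hx⟩
  -- points of the rest of the complex lie on the boundary
  have hbd : ∀ x ∈ C, x ∈ K'.space → ∃ v ∈ s, b v x = 0 := by
    intro x hx hx'
    obtain ⟨t, ht, hxt⟩ := SimplicialComplex.mem_space_iff.1 hx'
    rw [hK'] at ht
    have h1 : x ∈ convexHull ℝ (t ∩ s : Set E) := K.inter_subset_convexHull ht.1 hs ⟨hxt, hx⟩
    have h2 : ¬ s ⊆ t := fun h => ht.2 (hmax t ht.1 h).symm
    obtain ⟨v, hv, hvt⟩ := Finset.not_subset.1 h2
    refine ⟨v, hv, ?_⟩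
    have h3 : Convex ℝ {y | b v y = 0} := (convex_singleton (0:ℝ)).affine_preimage (b v)
    refine convexHull_min ?_ h3 h1
    rintro w ⟨hw, hws⟩
    have : v ≠ w := by rintro rfl; exact hvt hw
    simp [hb v hv w hws, this]
  -- interior point
  obtain ⟨p, hpU, hpC, hp⟩ : ∃ p ∈ U, p ∈ C ∧ ∀ v ∈ s, 0 < b v p := by
    obtain ⟨q, hqC, hqU⟩ := Set.not_disjoint_iff.1 hne
    have hn : (0:ℝ) < s.card := by exact_mod_cast sne.card_pos
    have hw : ∑ v ∈ s, (1 / (s.card : ℝ)) = 1 := by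
      rw [Finset.sum_const, nsmul_eq_mul]; field_simp
    set c : E := ∑ v ∈ s, (1 / (s.card : ℝ)) • v with hcdef
    have hcC : c ∈ C := Finset.mem_convexHull'.2 ⟨fun _ => 1 / (s.card : ℝ),
      fun _ _ => by positivity, hw, rfl⟩
    have hcb : ∀ v ∈ s, b v c = 1 / s.card := by
      intro v hv
      rw [hcdef, bary_sum _ _ (fun _ => 1 / (s.card : ℝ)) hw,
        Finset.sum_congr rfl (fun u hu => by rw [hb v hv u hu])]
      simp [hv]
    have hcont : Continuous (fun e : ℝ => AffineMap.lineMap q c e) :=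
      AffineMap.lineMap_continuous
    have h0 : ∀ᶠ e in nhdsWithin (0:ℝ) (Set.Ioi 0), AffineMap.lineMap q c e ∈ U := by
      apply Filter.Eventually.filter_mono nhdsWithin_le_nhds
      exact hcont.continuousAt.eventually_mem (hU.mem_nhds (by simpa using hqU))
    have h1 : ∀ᶠ e in nhdsWithin (0:ℝ) (Set.Ioi 0), e ∈ Set.Ioo (0:ℝ) 1 :=
      Ioo_mem_nhdsGT one_pos
    obtain ⟨e, he, he'⟩ := (h0.and h1).exists
    refine ⟨_, he, (convex_convexHull ℝ _).lineMap_mem hqC hcC ⟨he'.1.le, he'.2.le⟩, ?_⟩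
    intro v hv
    rw [AffineMap.apply_lineMap, AffineMap.lineMap_apply_ring, hcb v hv]
    have := (bary_hull hb hqC).1 v hv
    have h3 : 0 < e * (1 / (s.card : ℝ)) := mul_pos he'.1 (by positivity)
    have h4 : 0 ≤ (1 - e) * b v q := mul_nonneg (by linarith [he'.2]) this
    linarith
  obtain ⟨-, hp1, hpx⟩ := bary_hull hb hpC
  let μ : E → ℝ := fun x => s.sup' sne (fun v => 1 - b v x / b v p)
  have μc : Continuous μ :=
    Continuous.finset_sup'_apply sne (fun v _ => continuous_const.sub ((bcont v).div_const _))
  have μle : ∀ x, ∀ v ∈ s, b v p - b v x ≤ b v p * μ x := by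
    intro x v hv
    have h1 : 1 - b v x / b v p ≤ μ x := Finset.le_sup' (fun v => 1 - b v x / b v p) hv
    have h2 := mul_le_mul_of_nonneg_left h1 (hp v hv).le
    have h3 : b v p * (1 - b v x / b v p) = b v p - b v x := by
      have := (hp v hv).ne'
      field_simp
    linarith
  have μex : ∀ x, ∃ v ∈ s, b v p - b v x = b v p * μ x := by
    intro x
    obtain ⟨v, hv, h⟩ := Finset.exists_mem_eq_sup' sne (fun v => 1 - b v x / b v p)
    refine ⟨v, hv, ?_⟩
    have h' : μ x = 1 - b v x / b v p := h
    rw [h']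
    have := (hp v hv).ne'
    field_simp
  have μ1 : ∀ x ∈ C, μ x ≤ 1 := by
    intro x hx
    refine Finset.sup'_le _ _ fun v hv => ?_
    have := div_nonneg ((bary_hull hb hx).1 v hv) (hp v hv).le
    linarith
  have μbd : ∀ x ∈ C, x ∈ K'.space → μ x = 1 := by
    intro x hx hx'
    obtain ⟨v, hv, h⟩ := hbd x hx hx'
    have h1 := μle x v hv
    rw [h] at h1
    have h2 := hp v hv
    refine le_antisymm (μ1 x hx) ?_
    by_contra h3
    push Not at h3
    nlinarith
  have μpos : ∀ x ∈ C, x ∉ U → 0 < μ x := by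
    intro x hx hxU
    by_contra h
    push Not at h
    apply hxU
    obtain ⟨-, hx1, hxx⟩ := bary_hull hb hx
    have h1 : ∀ v ∈ s, b v p ≤ b v x := by
      intro v hv
      have := μle x v hv
      have := mul_nonpos_of_nonneg_of_nonpos (hp v hv).le h
      linarith
    have h2 := (Finset.sum_eq_sum_iff_of_le h1).1 (hp1.trans hx1.symm)
    rw [← hxx, Finset.sum_congr rfl (fun v hv => by rw [← h2 v hv]), hpx]
    exact hpU
  -- main properties of the push
  have hpush : ∀ x ∈ C, x ∉ U → ∀ t ∈ Set.Icc (0:ℝ) 1,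
      AffineMap.lineMap p x (1 - t + t / μ x) ∈ C ∧
      AffineMap.lineMap p x (1 - t + t / μ x) ∉ U ∧
      (t = 1 → AffineMap.lineMap p x (1 - t + t / μ x) ∈ K'.space) := by
    intro x hx hxU t ht
    have m0 := μpos x hx hxU
    have m1 := μ1 x hx
    obtain ⟨hx0, hx1, hxx⟩ := bary_hull hb hx
    set a := 1 - t + t / μ x with ha
    have ham : a * μ x = (1 - t) * μ x + t := by rw [ha]; field_simp
    have ham1 : a * μ x ≤ 1 := by rw [ham]; nlinarith [ht.1, ht.2]
    have ha1 : 1 ≤ a := by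
      have : t ≤ t / μ x := by rw [le_div_iff₀ m0]; nlinarith [ht.1]
      linarith
    set y := AffineMap.lineMap p x a with hy
    have hby : ∀ v, b v y = b v p - a * (b v p - b v x) := by
      intro v
      rw [hy, AffineMap.apply_lineMap, AffineMap.lineMap_apply_ring]; ring
    have hy0 : ∀ v ∈ s, 0 ≤ b v y := by
      intro v hv
      rw [hby]
      have h1 := mul_le_mul_of_nonneg_left (μle x v hv) (by linarith : 0 ≤ a)
      have h2 := mul_le_mul_of_nonneg_left ham1 (hp v hv).le
      nlinarith
    have hy1 : ∑ v ∈ s, b v y = 1 := by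
      simp only [hby, Finset.sum_sub_distrib, ← Finset.mul_sum, hp1, hx1]; ring
    have hyy : ∑ v ∈ s, b v y • v = y := by
      simp only [hby, sub_smul, mul_smul, Finset.sum_sub_distrib, ← Finset.smul_sum, hpx, hxx]
      rw [hy, AffineMap.lineMap_apply_module']
      module
    have hyC : y ∈ C := Finset.mem_convexHull'.2 ⟨fun v => b v y, hy0, hy1, hyy⟩
    refine ⟨hyC, ?_, ?_⟩
    · intro hyU
      apply hxU
      have h1 : AffineMap.lineMap p y (1 / a) ∈ U ∩ C :=
        hc.lineMap_mem ⟨hpU, hpC⟩ ⟨hyU, hyC⟩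
          ⟨by positivity, by rw [div_le_one (by linarith)]; exact ha1⟩
      have h2 : AffineMap.lineMap p y (1 / a) = x := by
        rw [hy, AffineMap.lineMap_apply_module', AffineMap.lineMap_apply_module',
          add_sub_cancel_right, smul_smul, one_div_mul_cancel (by linarith : a ≠ 0)]
        simp
      rw [h2] at h1
      exact h1.1
    · intro ht1
      obtain ⟨v, hv, h⟩ := μex x
      have hv0 : b v y = 0 := by
        rw [hby, h]
        have : a * μ x = 1 := by rw [ham, ht1]; ring
        linear_combination (-(b v p)) * this
      have hmem : y ∈ convexHull ℝ ((s.erase v : Finset E) : Set E) := by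
        refine Finset.mem_convexHull'.2 ⟨fun v => b v y,
          fun w hw => hy0 w (Finset.mem_of_mem_erase hw), ?_, ?_⟩
        · rw [← hy1, ← Finset.add_sum_erase s _ hv, hv0, zero_add]
        · conv_rhs => rw [← hyy, ← Finset.add_sum_erase s _ hv, hv0, zero_smul, zero_add]
      refine SimplicialComplex.mem_space_iff.2 ⟨s.erase v, ?_, hmem⟩
      rw [hK']
      refine ⟨K.down_closed hs (Finset.erase_subset _ _) ?_, ?_⟩
      · have := convexHull_nonempty_iff.1 ⟨y, hmem⟩
        exact_mod_cast this
      · intro h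
        have h' : s.erase v = s := h
        exact Finset.notMem_erase v s (h'.symm ▸ hv)
  let F : E × ℝ → E := fun q =>
    if q.1 ∈ C then AffineMap.lineMap p q.1 (1 - q.2 + q.2 / μ q.1) else q.1
  have FC : ∀ x t, x ∈ C → F (x, t) = AffineMap.lineMap p x (1 - t + t / μ x) :=
    fun x t h => if_pos h
  have FL : ∀ x t, x ∈ K'.space → F (x, t) = x := by
    intro x t h
    by_cases hx : x ∈ C
    · rw [FC x t hx, μbd x hx h]; simp
    · exact if_neg hx
  refine ⟨F, ?_, ?_, ?_, ?_, ?_⟩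
  · have e : (K.space \ U) ×ˢ Set.Icc (0:ℝ) 1 =
        ((C \ U) ×ˢ Set.Icc (0:ℝ) 1) ∪ ((K'.space \ U) ×ˢ Set.Icc (0:ℝ) 1) := by
      ext ⟨x, t⟩
      simp only [Set.mem_prod, Set.mem_sdiff, Set.mem_union, hsp]
      tauto
    rw [e]
    refine ContinuousOn.union_of_isClosed ?_ ?_ ((Ccl.sdiff hU).prod isClosed_Icc)
      ((Lcl.sdiff hU).prod isClosed_Icc)
    · refine ContinuousOn.congr (f := fun q : E × ℝ =>
        (1 - q.2 + q.2 / μ q.1) • (q.1 - p) + p) ?_ ?_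
      · refine ContinuousOn.add (ContinuousOn.smul (ContinuousOn.add (by fun_prop)
          (ContinuousOn.div (by fun_prop) (by fun_prop) ?_)) (by fun_prop)) (by fun_prop)
        rintro ⟨x, t⟩ ⟨hx, -⟩
        exact (μpos x hx.1 hx.2).ne'
      · rintro ⟨x, t⟩ ⟨hx, -⟩
        rw [FC x t hx.1, AffineMap.lineMap_apply_module']
    · refine ContinuousOn.congr continuousOn_fst ?_
      rintro ⟨x, t⟩ ⟨hx, -⟩
      exact FL x t hx.1
  · rintro x ⟨hx, hxU⟩ t ht
    rcases (hsp x).1 hx with h | h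
    · rw [FC x t h]
      have := hpush x h hxU t ht
      exact ⟨(hsp _).2 (Or.inl this.1), this.2.1⟩
    · rw [FL x t h]; exact ⟨hx, hxU⟩
  · rintro x ⟨hx, hxU⟩
    rcases (hsp x).1 hx with h | h
    · rw [FC x 0 h]; simp
    · exact FL x 0 h
  · rintro x ⟨hx, hxU⟩
    rcases (hsp x).1 hx with h | h
    · rw [FC x 1 h]
      have := hpush x h hxU 1 (by simp)
      exact ⟨this.2.2 rfl, this.2.1⟩
    · rw [FL x 1 h]; exact ⟨h, hxU⟩
  · rintro x - ⟨h, -⟩ t -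
    exact FL x t h

lemma sdr_main [FiniteDimensional ℝ E] (U : Set E) (hU : IsOpen U) (n : ℕ) :
    ∀ (K : SimplicialComplex ℝ E), K.faces.Finite → K.faces.ncard = n →
    (∀ s ∈ K.faces, Convex ℝ (U ∩ convexHull ℝ (s : Set E))) →
    SDRAux (K.space \ U) (⋃ s ∈ {s ∈ K.faces | Disjoint (convexHull ℝ (s : Set E)) U},
          convexHull ℝ (s : Set E)) := by
  induction n with
  | zero =>
    intro K hf hn hc
    apply SDRAux.refl
    rintro x ⟨hx, -⟩
    obtain ⟨t, ht, -⟩ := SimplicialComplex.mem_space_iff.1 hx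
    rw [(Set.ncard_eq_zero hf).1 hn] at ht
    exact ht.elim
  | succ n ih =>
    intro K hf hn hc
    by_cases hall : ∀ s ∈ K.faces, Disjoint (convexHull ℝ (s : Set E)) U
    · apply SDRAux.refl
      rintro x ⟨hx, -⟩
      obtain ⟨t, ht, hxt⟩ := SimplicialComplex.mem_space_iff.1 hx
      exact Set.mem_biUnion (show t ∈ {s ∈ K.faces | _} from ⟨ht, hall t ht⟩) hxt
    · push Not at hall
      obtain ⟨s0, hs0, hd0⟩ := hall
      obtain ⟨s, hs0s, hsm⟩ := hf.exists_le_maximal hs0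
      have hs : s ∈ K.faces := hsm.prop
      have hmax : ∀ t ∈ K.faces, s ⊆ t → s = t := fun t ht h => hsm.eq_of_le ht h
      have hd : ¬ Disjoint (convexHull ℝ (s : Set E)) U := fun h =>
        hd0 (h.mono_left (convexHull_mono (by exact_mod_cast hs0s)))
      let K' : SimplicialComplex ℝ E :=
        { faces := K.faces \ {s}
          indep := fun h => K.indep h.1
          isRelLowerSet_faces := by
            intro t ht
            refine ⟨SimplicialComplex.nonempty_of_mem_faces ht.1, fun u hu hne =>
              ⟨K.down_closed ht.1 hu hne, ?_⟩⟩
            rintro rfl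
            exact ht.2 (hmax t ht.1 hu).symm
          inter_subset_convexHull := fun h h' => K.inter_subset_convexHull h.1 h'.1 }
      have hK' : K'.faces = K.faces \ {s} := rfl
      have hA : {u ∈ K'.faces | Disjoint (convexHull ℝ (u : Set E)) U} =
          {u ∈ K.faces | Disjoint (convexHull ℝ (u : Set E)) U} := by
        ext u
        simp only [hK', Set.mem_ofPred_eq, Set.mem_sdiff, Set.mem_singleton_iff]
        constructor
        · rintro ⟨h, h'⟩; exact ⟨h.1, h'⟩
        · rintro ⟨h, h'⟩
          refine ⟨⟨h, ?_⟩, h'⟩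
          rintro rfl
          exact hd h'
      have h2 := ih K' (hf.subset Set.sdiff_subset)
        (by rw [hK', Set.ncard_sdiff_singleton_of_mem hs, hn]; rfl) (fun t ht => hc t ht.1)
      have h1 := radial K K' hf U hU s hs hmax (hc s hs) hK' hd
      rw [hA] at h2
      refine SDRAux.trans ?_ ?_ h1 h2
      · rintro x ⟨hx, hxU⟩
        obtain ⟨t, ht, hxt⟩ := SimplicialComplex.mem_space_iff.1 hx
        exact ⟨SimplicialComplex.mem_space_iff.2 ⟨t, ht.1, hxt⟩, hxU⟩
      · rintro x ⟨⟨-, hxU⟩, hx⟩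
        rw [← hA] at hx
        obtain ⟨t, ht, hxt⟩ := Set.mem_iUnion₂.1 hx
        exact ⟨SimplicialComplex.mem_space_iff.2 ⟨t, ht.1, hxt⟩, hxU⟩

end


/-- **Proposition (pushing into the complement of a convexly-intersecting open
set).** Let `K` be a simplicial complex with finitely many faces in a
finite-dimensional real inner product space and let `U` be an open set whose
intersection with each closed cell of `K` is convex. Then the underlying space
`|K_U|` of the maximal subcomplex of `K` avoiding `U` (the union of the closed
cells disjoint from `U`) is a strong deformation retract of `|K| \ U`. -/
theorem simplicialComplex_deformation_retract_onto_subcomplex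
    {E : Type*} [NormedAddCommGroup E] [InnerProductSpace ℝ E]
    [FiniteDimensional ℝ E]
    (K : SimplicialComplex ℝ E) (hKfin : K.faces.Finite)
    (U : Set E) (hUopen : IsOpen U)
    (hconv : ∀ s ∈ K.faces, Convex ℝ (U ∩ convexHull ℝ (s : Set E))) :
    ∃ H : C(↥(K.space \ U) × ↥(Set.Icc (0 : ℝ) 1), ↥(K.space \ U)),
      (∀ x : ↥(K.space \ U), H (x, ⟨0, by norm_num⟩) = x) ∧
      (∀ x : ↥(K.space \ U), ((H (x, ⟨1, by norm_num⟩) : ↥(K.space \ U)) : E) ∈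
        ⋃ s ∈ {s ∈ K.faces | Disjoint (convexHull ℝ (s : Set E)) U},
          convexHull ℝ (s : Set E)) ∧
      (∀ (x : ↥(K.space \ U)) (t : ↥(Set.Icc (0 : ℝ) 1)),
        (x : E) ∈ (⋃ s ∈ {s ∈ K.faces | Disjoint (convexHull ℝ (s : Set E)) U},
          convexHull ℝ (s : Set E)) → H (x, t) = x) := by

  obtain ⟨F, Fc, FX, F0, F1, FA⟩ := sdr_main U hUopen _ K hKfin rfl hconv
  refine ⟨⟨fun q => ⟨F (q.1, q.2), FX _ q.1.2 _ q.2.2⟩, ?_⟩, ?_, ?_, ?_⟩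
  · refine Continuous.subtype_mk ?_ _
    exact Fc.comp_continuous (f := fun q : ↥(K.space \ U) × ↥(Set.Icc (0 : ℝ) 1) =>
      ((q.1 : E), (q.2 : ℝ))) (by fun_prop) (fun q => ⟨q.1.2, q.2.2⟩)
  · intro x
    exact Subtype.ext (F0 _ x.2)
  · intro x
    exact F1 _ x.2
  · intro x t hx
    exact Subtype.ext (FA _ x.2 hx _ t.2)
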